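/- Let f : [0,1] → [0,∞) be concave. Then for every n ∈ ℕ, the function π ↦ (T_n f)(π) is concave on (0,1). -/

import Mathlib

open MeasureTheory Real Set Filter

/-- The natural parameter domain of the exponential family generated by `ν`. -/
def expDom (ν : Measure ℝ) : Set ℝ :=
  {u : ℝ | Integrable (fun x => Real.exp (u * x)) ν}

/-- The cumulant generating function `B(u) = log ∫ e^{u x} dν(x)`. -/
noncomputable def cgf (ν : Measure ℝ) (u : ℝ) : ℝ :=
  Real.log (∫ x, Real.exp (u * x) ∂ν)

/-- The (topological) support of a measure: points all of whose neighbourhoods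
have nonzero measure. -/
def msupport (μ : MeasureTheory.Measure ℝ) : Set ℝ :=
  {x : ℝ | ∀ U ∈ nhds x, μ U ≠ 0}

/-- The normalizing constant `Z(n,y) = ∫ e^{uy - nB(u)} dμ(u)`. -/
noncomputable def Z (ν μ : Measure ℝ) (n : ℕ) (y : ℝ) : ℝ :=
  ∫ u, Real.exp (u * y - (n : ℝ) * cgf ν u) ∂μ

/-- The posterior probability `q(n,y) = P(Θ > θ₀ | Y_n = y)`. -/
noncomputable def q (ν μ : Measure ℝ) (θ₀ : ℝ) (n : ℕ) (y : ℝ) : ℝ :=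
  (∫ u in Set.Ioi θ₀, Real.exp (u * y - (n : ℝ) * cgf ν u) ∂μ) / Z ν μ n y

/-- The posterior distribution `μ_{n,y}(du) = e^{uy - nB(u)} μ(du) / Z(n,y)`. -/
noncomputable def post (ν μ : Measure ℝ) (n : ℕ) (y : ℝ) : Measure ℝ :=
  (ENNReal.ofReal (Z ν μ n y))⁻¹ •
    μ.withDensity (fun u => ENNReal.ofReal (Real.exp (u * y - (n : ℝ) * cgf ν u)))

/-- The one-step transition operator: `(T_n f)(p) = E_{n,p}[f(Π_{n+1})]`, where
`Y n p` is the point on the `p`-level curve at time `n`. -/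
noncomputable def T (ν μ : Measure ℝ) (θ₀ : ℝ) (Y : ℕ → ℝ → ℝ) (n : ℕ)
    (f : ℝ → ℝ) (p : ℝ) : ℝ :=
  ∫ x, f (q ν μ θ₀ (n + 1) (Y n p + x)) *
      (Z ν μ (n + 1) (Y n p + x) / Z ν μ n (Y n p)) ∂ν

/-- The finite-horizon value functions `W k n p`. -/
noncomputable def W (ν μ : Measure ℝ) (θ₀ : ℝ) (Y : ℕ → ℝ → ℝ) (c : ℝ) :
    ℕ → ℕ → ℝ → ℝ
  | 0, _, p => min p (1 - p)
  | k + 1, n, p =>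
      min (min p (1 - p)) (c + T ν μ θ₀ Y n (W ν μ θ₀ Y c k (n + 1)) p)

/-- The value function `V(n,p) = lim_k W_k(n,p) = ⨅ k, W_k(n,p)`. -/
noncomputable def Vfun (ν μ : Measure ℝ) (θ₀ : ℝ) (Y : ℕ → ℝ → ℝ) (c : ℝ)
    (n : ℕ) (p : ℝ) : ℝ :=
  ⨅ k : ℕ, W ν μ θ₀ Y c k n p



/-- A Chebyshev-type comparison: if `a` and `b` have the same finite total mass and `φ` is
smaller where `a > b` than where `a ≤ b`, then `∫ φ a ≤ ∫ φ b`. -/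
lemma cheb_aux {m : Measure ℝ} (φ a b : ℝ → ENNReal) (hφ : Measurable φ)
    (ha : Measurable a) (hb : Measurable b) (hab : ∫⁻ x, a x ∂m = ∫⁻ x, b x ∂m) (hfin : ∫⁻ x, b x ∂m ≠ ⊤)
    (S : Set ℝ) (hS : ∀ᵐ x ∂m, x ∈ S)
    (hmono : ∀ x ∈ S, ∀ z ∈ S, b x < a x → a z ≤ b z → φ x ≤ φ z) :
    ∫⁻ x, φ x * a x ∂m ≤ ∫⁻ x, φ x * b x ∂m := by
  by_cases htop : ∫⁻ x, φ x * b x ∂m = ⊤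
  · rw [htop]; exact le_top
  have hP : Measurable fun x => a x - b x := ha.sub hb
  have hM : Measurable fun x => b x - a x := hb.sub ha
  have hφP : Measurable fun x => φ x * (a x - b x) := hφ.mul hP
  have hφM : Measurable fun x => φ x * (b x - a x) := hφ.mul hM
  have hφa : Measurable fun x => φ x * a x := hφ.mul ha
  have hφb : Measurable fun x => φ x * b x := hφ.mul hb
  have hmax : ∀ x, a x + (b x - a x) = b x + (a x - b x) := by
    intro x
    rcases le_total (a x) (b x) with h | h
    · rw [add_tsub_cancel_of_le h, tsub_eq_zero_of_le h, add_zero]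
    · rw [add_tsub_cancel_of_le h, tsub_eq_zero_of_le h, add_zero]
  -- equal masses of positive and negative parts
  have hmass : ∫⁻ x, (b x - a x) ∂m = ∫⁻ x, (a x - b x) ∂m := by
    have h : ∫⁻ x, a x ∂m + ∫⁻ x, (b x - a x) ∂m = ∫⁻ x, b x ∂m + ∫⁻ x, (a x - b x) ∂m := by
      rw [← lintegral_add_left ha, ← lintegral_add_left hb]
      exact lintegral_congr hmax
    rw [hab] at h
    exact (ENNReal.add_right_inj hfin).1 h
  have hmfin : ∫⁻ x, (a x - b x) ∂m ≠ ⊤ := by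
    refine ne_top_of_le_ne_top hfin ?_
    rw [← hab]
    exact lintegral_mono fun x => tsub_le_self
  have hkey : ∫⁻ x, φ x * (a x - b x) ∂m ≤ ∫⁻ x, φ x * (b x - a x) ∂m := by
    by_cases h0 : ∫⁻ x, (a x - b x) ∂m = 0
    · rw [lintegral_eq_zero_iff hP] at h0
      have : ∫⁻ x, φ x * (a x - b x) ∂m = 0 := by
        rw [← lintegral_zero (μ := m)]
        refine lintegral_congr_ae ?_
        filter_upwards [h0] with x hx
        have hx' : a x - b x = 0 := hx
        rw [hx', mul_zero]
      rw [this]; exact zero_le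
    · have h1 : (∫⁻ x, φ x * (a x - b x) ∂m) * (∫⁻ z, (b z - a z) ∂m)
          ≤ (∫⁻ z, φ z * (b z - a z) ∂m) * (∫⁻ x, (a x - b x) ∂m) := by
        rw [mul_comm (∫⁻ z, φ z * (b z - a z) ∂m)]
        rw [← lintegral_mul_const _ hφP, ← lintegral_mul_const _ hP]
        refine lintegral_mono_ae ?_
        filter_upwards [hS] with x hx
        rw [← lintegral_const_mul _ hM, ← lintegral_const_mul _ hφM]
        refine lintegral_mono_ae ?_
        filter_upwards [hS] with z hz
        rcases le_or_gt (a x) (b x) with h | h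
        · simp [tsub_eq_zero_of_le h]
        rcases le_or_gt (a z) (b z) with h' | h'
        · have := hmono x hx z hz h h'
          calc φ x * (a x - b x) * (b z - a z) ≤ φ z * (a x - b x) * (b z - a z) := by gcongr
            _ = _ := by ring
        · simp [tsub_eq_zero_of_le h'.le]
      rw [hmass] at h1
      exact (ENNReal.mul_le_mul_iff_left h0 hmfin).1 h1
  have hsum : ∫⁻ x, φ x * a x ∂m + ∫⁻ x, φ x * (b x - a x) ∂m
      = ∫⁻ x, φ x * b x ∂m + ∫⁻ x, φ x * (a x - b x) ∂m := by
    rw [← lintegral_add_left hφa,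
      ← lintegral_add_left hφb]
    refine lintegral_congr fun x => ?_
    rw [← mul_add, ← mul_add, hmax]
  have hfin2 : ∫⁻ x, φ x * (b x - a x) ∂m ≠ ⊤ := by
    refine ne_top_of_le_ne_top htop (lintegral_mono fun x => ?_)
    gcongr
    exact tsub_le_self
  refine (ENNReal.add_le_add_iff_right hfin2).1 ?_
  rw [hsum]
  gcongr

lemma exists_supergrad (f : ℝ → ℝ) (hf : ConcaveOn ℝ (Set.Icc 0 1) f) (x : ℝ)
    (hx : x ∈ Set.Ioo (0 : ℝ) 1) :
    ∃ s : ℝ, ∀ p ∈ Set.Icc (0 : ℝ) 1, f p ≤ f x + s * (p - x) := by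
  have hg := hf.neg
  have hxi : x ∈ interior (Set.Icc (0 : ℝ) 1) := by rwa [interior_Icc]
  refine ⟨- derivWithin (-f) (Set.Ioi x) x, fun p hp => ?_⟩
  rcases lt_trichotomy p x with h | h | h
  · have h1 := hg.slope_le_leftDeriv_of_mem_interior hp hxi h
    have h2 := hg.leftDeriv_le_rightDeriv_of_mem_interior hxi
    have h3 := h1.trans h2
    rw [slope_def_field, div_le_iff₀ (by linarith)] at h3
    simp only [Pi.neg_apply] at h3
    linarith
  · subst h; simp
  · have h3 := hg.rightDeriv_le_slope_of_mem_interior hxi hp h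
    rw [slope_def_field, le_div_iff₀ (by linarith)] at h3
    simp only [Pi.neg_apply] at h3
    linarith

/-- unnormalised posterior weight -/
noncomputable def wt (ν : Measure ℝ) (n : ℕ) (y u : ℝ) : ℝ :=
  Real.exp (u * y - (n : ℝ) * cgf ν u)

lemma measurable_cgf' (ν : Measure ℝ) [SigmaFinite ν] : Measurable (cgf ν) := by
  unfold cgf
  refine Real.measurable_log.comp ?_
  refine StronglyMeasurable.measurable ?_
  refine StronglyMeasurable.integral_prod_right (f := fun u x : ℝ => Real.exp (u * x)) ?_
  refine Measurable.stronglyMeasurable ?_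
  fun_prop

lemma measurable_wt (ν : Measure ℝ) [SigmaFinite ν] (n : ℕ) :
    Measurable (Function.uncurry (wt ν n)) := by
  have := measurable_cgf' ν
  unfold wt Function.uncurry
  fun_prop

lemma wt_integrable {ν μ : Measure ℝ} [SigmaFinite ν]
    (hint : ∀ (n : ℕ) (y : ℝ),
      Integrable (fun u => (1 + |u|) * Real.exp (u * y - (n : ℝ) * cgf ν u)) μ) (n : ℕ) (y : ℝ) :
    Integrable (wt ν n y) μ := by
  refine (hint n y).mono' ?_ ?_
  · have := measurable_cgf' ν
    unfold wt
    exact Measurable.aestronglyMeasurable (by fun_prop)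
  · refine Filter.Eventually.of_forall fun u => ?_
    unfold wt
    rw [Real.norm_eq_abs, abs_of_pos (Real.exp_pos _)]
    have := abs_nonneg u
    have := Real.exp_pos (u * y - (n : ℝ) * cgf ν u)
    nlinarith

noncomputable def phi (ν : Measure ℝ) (H : ℝ → ENNReal) (u : ℝ) : ENNReal :=
  ∫⁻ x, H x * ENNReal.ofReal (Real.exp (u * x - cgf ν u)) ∂ν

lemma measurable_phi (ν : Measure ℝ) [SigmaFinite ν] (H : ℝ → ENNReal) (hH : Measurable H) :
    Measurable (phi ν H) := by
  have := measurable_cgf' ν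
  unfold phi
  refine Measurable.lintegral_prod_right'
    (f := fun p : ℝ × ℝ => H p.2 * ENNReal.ofReal (Real.exp (p.1 * p.2 - cgf ν p.1))) ?_
  fun_prop

lemma tonelli_wt {ν μ : Measure ℝ} [SigmaFinite ν] [IsProbabilityMeasure μ]
    (hint : ∀ (n : ℕ) (y : ℝ),
      Integrable (fun u => (1 + |u|) * Real.exp (u * y - (n : ℝ) * cgf ν u)) μ)
    (n : ℕ) (y : ℝ) (S : Set ℝ) (H : ℝ → ENNReal) (hH : Measurable H) :
    ∫⁻ x, H x * ENNReal.ofReal (∫ u in S, wt ν (n + 1) (y + x) u ∂μ) ∂ν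
      = ∫⁻ u in S, phi ν H u * ENNReal.ofReal (wt ν n y u) ∂μ := by
  have hc := measurable_cgf' ν
  have hw : Measurable (fun p : ℝ × ℝ => wt ν (n + 1) p.1 p.2) := measurable_wt ν (n + 1)
  have h1 : ∀ x, H x * ENNReal.ofReal (∫ u in S, wt ν (n + 1) (y + x) u ∂μ)
      = ∫⁻ u in S, H x * ENNReal.ofReal (wt ν (n + 1) (y + x) u) ∂μ := by
    intro x
    rw [ofReal_integral_eq_lintegral_ofReal (wt_integrable hint _ _).integrableOn
      (Filter.Eventually.of_forall fun u => (Real.exp_pos _).le)]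
    rw [lintegral_const_mul]
    exact (hw.comp (measurable_const.prodMk measurable_id)).ennreal_ofReal
  simp_rw [h1]
  rw [lintegral_lintegral_swap]
  · refine lintegral_congr fun u => ?_
    unfold phi
    rw [← lintegral_mul_const]
    · refine lintegral_congr fun x => ?_
      rw [mul_assoc, ← ENNReal.ofReal_mul (Real.exp_pos _).le]
      unfold wt
      rw [← Real.exp_add]
      congr 3
      push_cast
      ring
    · fun_prop
  · refine Measurable.aemeasurable ?_
    have : Measurable fun p : ℝ × ℝ => ENNReal.ofReal (wt ν (n + 1) (y + p.1) p.2) :=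
      (hw.comp ((measurable_const.add measurable_fst).prodMk measurable_snd)).ennreal_ofReal
    exact (hH.comp measurable_fst).mul this

lemma lint_p {ν : Measure ℝ} (hν : ν ≠ 0) {u : ℝ} (hu : u ∈ expDom ν) :
    ∫⁻ x, ENNReal.ofReal (Real.exp (u * x - cgf ν u)) ∂ν = 1 := by
  have hI : Integrable (fun x => Real.exp (u * x)) ν := hu
  have hpos : 0 < ∫ x, Real.exp (u * x) ∂ν := by
    have : NeZero ν := ⟨hν⟩
    exact integral_exp_pos hI
  have h : ∀ x, Real.exp (u * x - cgf ν u) = Real.exp (u * x) / ∫ x, Real.exp (u * x) ∂ν := by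
    intro x
    rw [Real.exp_sub, cgf, Real.exp_log hpos]
  simp_rw [h]
  rw [← ofReal_integral_eq_lintegral_ofReal (hI.div_const _)
    (Filter.Eventually.of_forall fun x => by positivity), integral_div, div_self hpos.ne']
  simp

lemma phi_anti {ν : Measure ℝ} (hν : ν ≠ 0) {u v : ℝ} (hu : u ∈ expDom ν) (hv : v ∈ expDom ν)
    (huv : u ≤ v) (H : ℝ → ENNReal) (hH : Antitone H) : phi ν H v ≤ phi ν H u := by
  rcases huv.eq_or_lt with rfl | huv
  · exact le_rfl
  refine cheb_aux H _ _ hH.measurable (by fun_prop) (by fun_prop)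
    ?_ ?_ Set.univ (by simp) ?_
  · rw [lint_p hν hu, lint_p hν hv]
  · rw [lint_p hν hu]; simp
  · intro x _ z _ h1 h2
    rw [ENNReal.ofReal_lt_ofReal_iff (Real.exp_pos _), Real.exp_lt_exp] at h1
    rw [ENNReal.ofReal_le_ofReal_iff (Real.exp_pos _).le, Real.exp_le_exp] at h2
    refine hH ?_
    by_contra! h
    nlinarith

lemma phi_mono {ν : Measure ℝ} (hν : ν ≠ 0) {u v : ℝ} (hu : u ∈ expDom ν) (hv : v ∈ expDom ν)
    (huv : u ≤ v) (H : ℝ → ENNReal) (hH : Monotone H) : phi ν H u ≤ phi ν H v := by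
  rcases huv.eq_or_lt with rfl | huv
  · exact le_rfl
  refine cheb_aux H _ _ hH.measurable (by fun_prop) (by fun_prop)
    ?_ ?_ Set.univ (by simp) ?_
  · rw [lint_p hν hu, lint_p hν hv]
  · rw [lint_p hν hv]; simp
  · intro x _ z _ h1 h2
    rw [ENNReal.ofReal_lt_ofReal_iff (Real.exp_pos _), Real.exp_lt_exp] at h1
    rw [ENNReal.ofReal_le_ofReal_iff (Real.exp_pos _).le, Real.exp_le_exp] at h2
    refine hH ?_
    by_contra! h
    nlinarith

lemma ae_expDom {ν μ : Measure ℝ} (hsupp : msupport μ ⊆ interior (expDom ν)) :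
    ∀ᵐ u ∂μ, u ∈ expDom ν := by
  filter_upwards [Measure.support_mem_ae (μ := μ)] with u hu
  refine interior_subset (hsupp ?_)
  intro U hU
  exact ((Measure.mem_support_iff_forall u).1 hu U hU).ne'

lemma setInt_pos {ν μ : Measure ℝ} [SigmaFinite ν]
    (hint : ∀ (n : ℕ) (y : ℝ),
      Integrable (fun u => (1 + |u|) * Real.exp (u * y - (n : ℝ) * cgf ν u)) μ)
    (n : ℕ) (y : ℝ) (S : Set ℝ) (hS : μ S ≠ 0) : 0 < ∫ u in S, wt ν n y u ∂μ := by
  have : NeZero (μ.restrict S) := ⟨by simpa using hS⟩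
  exact integral_exp_pos (f := fun u => u * y - (n : ℝ) * cgf ν u)
    (wt_integrable hint n y).integrableOn

lemma Z_split {ν μ : Measure ℝ} [SigmaFinite ν]
    (hint : ∀ (n : ℕ) (y : ℝ),
      Integrable (fun u => (1 + |u|) * Real.exp (u * y - (n : ℝ) * cgf ν u)) μ) (θ₀ : ℝ)
    (n : ℕ) (y : ℝ) :
    Z ν μ n y = (∫ u in Set.Ioi θ₀, wt ν n y u ∂μ) + ∫ u in Set.Iic θ₀, wt ν n y u ∂μ := by
  rw [← Set.compl_Ioi, integral_add_compl measurableSet_Ioi (wt_integrable hint n y)]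
  rfl

lemma q_eq (ν μ : Measure ℝ) (θ₀ : ℝ) (n : ℕ) (y : ℝ) :
    q ν μ θ₀ n y = (∫ u in Set.Ioi θ₀, wt ν n y u ∂μ) / Z ν μ n y := rfl

lemma q_mono {ν μ : Measure ℝ} [SigmaFinite ν]
    (hint : ∀ (n : ℕ) (y : ℝ),
      Integrable (fun u => (1 + |u|) * Real.exp (u * y - (n : ℝ) * cgf ν u)) μ) (θ₀ : ℝ)
    (hR : μ (Set.Ioi θ₀) ≠ 0) (hL : μ (Set.Iic θ₀) ≠ 0) (n : ℕ) :
    Monotone (q ν μ θ₀ n) := by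
  intro y y' hyy
  have hG := setInt_pos hint n y _ hR
  have hG' := setInt_pos hint n y' _ hR
  have hLp := setInt_pos hint n y _ hL
  have hLp' := setInt_pos hint n y' _ hL
  have e : ∀ u, wt ν n y' u = Real.exp (u * (y' - y)) * wt ν n y u := by
    intro u
    unfold wt
    rw [← Real.exp_add]; congr 1; ring
  have h1 : Real.exp (θ₀ * (y' - y)) * ∫ u in Set.Ioi θ₀, wt ν n y u ∂μ
      ≤ ∫ u in Set.Ioi θ₀, wt ν n y' u ∂μ := by
    rw [← integral_const_mul]
    refine setIntegral_mono_on ((wt_integrable hint n y).integrableOn.const_mul _)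
      (wt_integrable hint n y').integrableOn measurableSet_Ioi fun u hu => ?_
    rw [e]
    refine mul_le_mul_of_nonneg_right ?_ (Real.exp_pos _).le
    exact Real.exp_le_exp.2 (mul_le_mul_of_nonneg_right (le_of_lt hu) (by linarith))
  have h2 : ∫ u in Set.Iic θ₀, wt ν n y' u ∂μ
      ≤ Real.exp (θ₀ * (y' - y)) * ∫ u in Set.Iic θ₀, wt ν n y u ∂μ := by
    rw [← integral_const_mul]
    refine setIntegral_mono_on (wt_integrable hint n y').integrableOn
      ((wt_integrable hint n y).integrableOn.const_mul _) measurableSet_Iic fun u hu => ?_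
    rw [e]
    refine mul_le_mul_of_nonneg_right ?_ (Real.exp_pos _).le
    exact Real.exp_le_exp.2 (mul_le_mul_of_nonneg_right hu (by linarith))
  rw [q_eq, q_eq, Z_split hint θ₀, Z_split hint θ₀]
  rw [div_le_div_iff₀ (by positivity) (by positivity)]
  set c := Real.exp (θ₀ * (y' - y))
  nlinarith [mul_le_mul_of_nonneg_right h1 hLp.le, mul_le_mul_of_nonneg_left h2 hG.le]

/-- The key computation: rewriting the expectation of an affine-type integrand. -/
lemma TL_calc {ν μ : Measure ℝ} [SigmaFinite ν] [IsProbabilityMeasure μ]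
    (hint : ∀ (n : ℕ) (y : ℝ),
      Integrable (fun u => (1 + |u|) * Real.exp (u * y - (n : ℝ) * cgf ν u)) μ) (θ₀ : ℝ)
    (hR : μ (Set.Ioi θ₀) ≠ 0) (hL : μ (Set.Iic θ₀) ≠ 0) (n : ℕ) (y : ℝ)
    (h k : ℝ → ℝ) (hh : Measurable h) (hk : Measurable k) (hh0 : ∀ x, 0 ≤ h x)
    (hk0 : ∀ x, 0 ≤ k x) :
    ∫⁻ x, ENNReal.ofReal ((q ν μ θ₀ (n + 1) (y + x) * h x +
        (1 - q ν μ θ₀ (n + 1) (y + x)) * k x) * (Z ν μ (n + 1) (y + x) / Z ν μ n y)) ∂ν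
      = ENNReal.ofReal (1 / Z ν μ n y) *
        ((∫⁻ u in Set.Ioi θ₀, phi ν (fun x => ENNReal.ofReal (h x)) u
            * ENNReal.ofReal (wt ν n y u) ∂μ)
        + ∫⁻ u in Set.Iic θ₀, phi ν (fun x => ENNReal.ofReal (k x)) u
            * ENNReal.ofReal (wt ν n y u) ∂μ) := by
  rw [← tonelli_wt hint n y _ _ hh.ennreal_ofReal, ← tonelli_wt hint n y _ _ hk.ennreal_ofReal]
  have hw : Measurable (fun p : ℝ × ℝ => wt ν (n + 1) p.1 p.2) := measurable_wt ν (n + 1)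
  have hmeas : ∀ S : Set ℝ, Measurable fun x => ∫ u in S, wt ν (n + 1) (y + x) u ∂μ := by
    intro S
    refine StronglyMeasurable.measurable ?_
    refine StronglyMeasurable.integral_prod_right (f := fun x u : ℝ => wt ν (n + 1) (y + x) u) ?_
    refine Measurable.stronglyMeasurable ?_
    exact hw.comp ((measurable_const.add measurable_fst).prodMk measurable_snd)
  have hm1 := hmeas (Set.Ioi θ₀)
  have hm2 := hmeas (Set.Iic θ₀)
  have k1 : Measurable fun x => ENNReal.ofReal (h x) *
      ENNReal.ofReal (∫ u in Set.Ioi θ₀, wt ν (n + 1) (y + x) u ∂μ) :=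
    hh.ennreal_ofReal.mul hm1.ennreal_ofReal
  have k2 : Measurable fun x => ENNReal.ofReal (k x) *
      ENNReal.ofReal (∫ u in Set.Iic θ₀, wt ν (n + 1) (y + x) u ∂μ) :=
    hk.ennreal_ofReal.mul hm2.ennreal_ofReal
  have k3 : Measurable fun x => ENNReal.ofReal (h x) *
      ENNReal.ofReal (∫ u in Set.Ioi θ₀, wt ν (n + 1) (y + x) u ∂μ) + ENNReal.ofReal (k x) *
      ENNReal.ofReal (∫ u in Set.Iic θ₀, wt ν (n + 1) (y + x) u ∂μ) := k1.add k2
  rw [← lintegral_add_left k1, ← lintegral_const_mul _ k3]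
  refine lintegral_congr fun x => ?_
  have hG := setInt_pos hint (n + 1) (y + x) _ hR
  have hLp := setInt_pos hint (n + 1) (y + x) _ hL
  have hG0 := setInt_pos hint n y _ hR
  have hLp0 := setInt_pos hint n y _ hL
  have hZ0 : 0 < Z ν μ n y := by rw [Z_split hint θ₀]; positivity
  have hh0 := hh0 x
  have hk0 := hk0 x
  rw [← ENNReal.ofReal_mul hh0, ← ENNReal.ofReal_mul hk0,
    ← ENNReal.ofReal_add (by positivity) (by positivity), ← ENNReal.ofReal_mul (by positivity)]
  congr 1
  rw [q_eq, Z_split hint θ₀ (n + 1)]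
  field_simp
  ring

lemma conv_aux (c₁ c₂ d₁ d₂ : ℝ) (h₁ : 0 ≤ c₁) (h₂ : 0 ≤ c₂) :
    ConvexOn ℝ Set.univ (fun u : ℝ => c₁ * Real.exp (u * d₁) + c₂ * Real.exp (u * d₂)) := by
  have h : ∀ d : ℝ, ConvexOn ℝ Set.univ (fun u : ℝ => Real.exp (u * d)) := by
    intro d
    have := convexOn_exp.comp_linearMap (LinearMap.mulRight ℝ d)
    simpa [Function.comp_def] using this
  exact ((h d₁).smul h₁).add ((h d₂).smul h₂)

lemma conv_three {g : ℝ → ℝ} (hg : ConvexOn ℝ Set.univ g) {D x u z : ℝ} (hxu : x ≤ u)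
    (huz : u ≤ z) (hx : g x ≤ D) (hz : g z ≤ D) : g u ≤ D :=
  (hg.le_max_of_mem_Icc (Set.mem_univ x) (Set.mem_univ z) ⟨hxu, huz⟩).trans (max_le hx hz)

lemma weighted {ν μ : Measure ℝ} [SigmaFinite ν] [IsProbabilityMeasure μ] (hν : ν ≠ 0)
    (hsupp : msupport μ ⊆ interior (expDom ν))
    (hint : ∀ (n : ℕ) (y : ℝ),
      Integrable (fun u => (1 + |u|) * Real.exp (u * y - (n : ℝ) * cgf ν u)) μ) (θ₀ : ℝ)
    (hR : μ (Set.Ioi θ₀) ≠ 0) (hL : μ (Set.Iic θ₀) ≠ 0) (n : ℕ) (y₀ y₁ y₂ a b c : ℝ)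
    (ha : 0 ≤ a) (hb : 0 ≤ b) (hc : 0 ≤ c)
    (hRe : a * (∫ u in Set.Ioi θ₀, wt ν n y₁ u ∂μ) + b * (∫ u in Set.Ioi θ₀, wt ν n y₂ u ∂μ)
      = c * ∫ u in Set.Ioi θ₀, wt ν n y₀ u ∂μ)
    (hLe : a * (∫ u in Set.Iic θ₀, wt ν n y₁ u ∂μ) + b * (∫ u in Set.Iic θ₀, wt ν n y₂ u ∂μ)
      = c * ∫ u in Set.Iic θ₀, wt ν n y₀ u ∂μ)
    (H K : ℝ → ENNReal) (hH : Antitone H) (hK : Monotone K) :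
    ENNReal.ofReal a * ((∫⁻ u in Set.Ioi θ₀, phi ν H u * ENNReal.ofReal (wt ν n y₁ u) ∂μ)
        + ∫⁻ u in Set.Iic θ₀, phi ν K u * ENNReal.ofReal (wt ν n y₁ u) ∂μ)
      + ENNReal.ofReal b * ((∫⁻ u in Set.Ioi θ₀, phi ν H u * ENNReal.ofReal (wt ν n y₂ u) ∂μ)
        + ∫⁻ u in Set.Iic θ₀, phi ν K u * ENNReal.ofReal (wt ν n y₂ u) ∂μ)
      ≤ ENNReal.ofReal c * ((∫⁻ u in Set.Ioi θ₀, phi ν H u * ENNReal.ofReal (wt ν n y₀ u) ∂μ)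
        + ∫⁻ u in Set.Iic θ₀, phi ν K u * ENNReal.ofReal (wt ν n y₀ u) ∂μ) := by
  have hwm : ∀ y, Measurable (wt ν n y) := fun y =>
    (measurable_wt ν n).comp (measurable_const.prodMk measurable_id)
  have hwp : ∀ y u, 0 < wt ν n y u := fun y u => Real.exp_pos _
  have hwi := wt_integrable hint n
  set A : ℝ → ℝ := fun u => a * wt ν n y₁ u + b * wt ν n y₂ u with hA
  set C : ℝ → ℝ := fun u => c * wt ν n y₀ u with hC
  have hAm : Measurable A := ((hwm _).const_mul a).add ((hwm _).const_mul b)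
  have hCm : Measurable C := (hwm _).const_mul c
  have hA0 : ∀ u, 0 ≤ A u := fun u =>
    add_nonneg (mul_nonneg ha (hwp _ _).le) (mul_nonneg hb (hwp _ _).le)
  have hC0 : ∀ u, 0 ≤ C u := fun u => mul_nonneg hc (hwp _ _).le
  have hAi : Integrable A μ := ((hwi _).const_mul a).add ((hwi _).const_mul b)
  have hCi : Integrable C μ := (hwi _).const_mul c
  have hAS : ∀ S : Set ℝ, ∫ u in S, A u ∂μ
      = a * (∫ u in S, wt ν n y₁ u ∂μ) + b * (∫ u in S, wt ν n y₂ u ∂μ) := by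
    intro S
    rw [← integral_const_mul, ← integral_const_mul, ← integral_add]
    · exact ((hwi _).const_mul a).integrableOn
    · exact ((hwi _).const_mul b).integrableOn
  have hCS : ∀ S : Set ℝ, ∫ u in S, C u ∂μ = c * (∫ u in S, wt ν n y₀ u ∂μ) := by
    intro S
    rw [← integral_const_mul]
  set g : ℝ → ℝ := fun u => a * Real.exp (u * (y₁ - y₀)) + b * Real.exp (u * (y₂ - y₀)) with hg
  have hgc : ConvexOn ℝ Set.univ g := conv_aux a b _ _ ha hb
  have hAg : ∀ u, A u = g u * wt ν n y₀ u := by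
    intro u
    have e : ∀ y, wt ν n y u = Real.exp (u * (y - y₀)) * wt ν n y₀ u := by
      intro y
      unfold wt
      rw [← Real.exp_add]; congr 1; ring
    simp only [hA, hg]
    rw [e y₁, e y₂]
    ring
  have hle : ∀ u, A u ≤ C u ↔ g u ≤ c := by
    intro u
    rw [hAg]
    exact mul_le_mul_iff_left₀ (hwp _ _)
  have hlt : ∀ u, C u < A u ↔ c < g u := fun u => by
    rw [← not_le, hle, not_le]
  have hexists : ∀ S : Set ℝ, μ S ≠ 0 → ∫ u in S, A u ∂μ = ∫ u in S, C u ∂μ →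
      ∃ u ∈ S, g u ≤ c := by
    intro S hS he
    obtain ⟨u, hu, hu'⟩ := exists_setAverage_le (f := fun u => C u - A u) hS
      (measure_ne_top μ S) (hCi.sub hAi).integrableOn
    refine ⟨u, hu, (hle u).1 ?_⟩
    rw [setAverage_eq, integral_sub hCi.integrableOn hAi.integrableOn, he] at hu'
    simpa using hu'
  have heR : ∫ u in Set.Ioi θ₀, A u ∂μ = ∫ u in Set.Ioi θ₀, C u ∂μ := by rw [hAS, hCS, hRe]
  have heL : ∫ u in Set.Iic θ₀, A u ∂μ = ∫ u in Set.Iic θ₀, C u ∂μ := by rw [hAS, hCS, hLe]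
  have hθ : g θ₀ ≤ c := by
    obtain ⟨r, hr, hr'⟩ := hexists _ hR heR
    obtain ⟨l, hl, hl'⟩ := hexists _ hL heL
    exact conv_three hgc hl (le_of_lt hr) hl' hr'
  have hsplit : ∀ (S : Set ℝ) (φ : ℝ → ENNReal), Measurable φ →
      ∫⁻ u in S, φ u * ENNReal.ofReal (A u) ∂μ =
        ENNReal.ofReal a * (∫⁻ u in S, φ u * ENNReal.ofReal (wt ν n y₁ u) ∂μ)
        + ENNReal.ofReal b * (∫⁻ u in S, φ u * ENNReal.ofReal (wt ν n y₂ u) ∂μ) := by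
    intro S φ hφ
    have m1 : Measurable fun u => φ u * ENNReal.ofReal (wt ν n y₁ u) :=
      hφ.mul (hwm _).ennreal_ofReal
    have m2 : Measurable fun u => φ u * ENNReal.ofReal (wt ν n y₂ u) :=
      hφ.mul (hwm _).ennreal_ofReal
    rw [← lintegral_const_mul _ m1, ← lintegral_const_mul _ m2,
      ← lintegral_add_left (m1.const_mul _)]
    refine lintegral_congr fun u => ?_
    simp only [hA]
    rw [ENNReal.ofReal_add (mul_nonneg ha (hwp _ _).le) (mul_nonneg hb (hwp _ _).le),
      ENNReal.ofReal_mul ha, ENNReal.ofReal_mul hb]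
    ring
  have hsplitC : ∀ (S : Set ℝ) (φ : ℝ → ENNReal), Measurable φ →
      ∫⁻ u in S, φ u * ENNReal.ofReal (C u) ∂μ =
        ENNReal.ofReal c * (∫⁻ u in S, φ u * ENNReal.ofReal (wt ν n y₀ u) ∂μ) := by
    intro S φ hφ
    have m1 : Measurable fun u => φ u * ENNReal.ofReal (wt ν n y₀ u) :=
      hφ.mul (hwm _).ennreal_ofReal
    rw [← lintegral_const_mul _ m1]
    refine lintegral_congr fun u => ?_
    simp only [hC]
    rw [ENNReal.ofReal_mul hc]
    ring
  have hch : ∀ (S : Set ℝ) (φ : ℝ → ENNReal), MeasurableSet S → Measurable φ →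
      ∫ u in S, A u ∂μ = ∫ u in S, C u ∂μ →
      (∀ u ∈ S ∩ expDom ν, ∀ v ∈ S ∩ expDom ν, c < g u → g v ≤ c → φ u ≤ φ v) →
      ∫⁻ u in S, φ u * ENNReal.ofReal (A u) ∂μ ≤ ∫⁻ u in S, φ u * ENNReal.ofReal (C u) ∂μ := by
    intro S φ hS hφ he hm
    refine cheb_aux φ (fun u => ENNReal.ofReal (A u)) (fun u => ENNReal.ofReal (C u)) hφ
      hAm.ennreal_ofReal hCm.ennreal_ofReal ?_ ?_ (S ∩ expDom ν) ?_ ?_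
    · rw [← ofReal_integral_eq_lintegral_ofReal hAi.integrableOn
          (Filter.Eventually.of_forall hA0),
        ← ofReal_integral_eq_lintegral_ofReal hCi.integrableOn
          (Filter.Eventually.of_forall hC0), he]
    · rw [← ofReal_integral_eq_lintegral_ofReal hCi.integrableOn
          (Filter.Eventually.of_forall hC0)]
      exact ENNReal.ofReal_ne_top
    · filter_upwards [ae_restrict_mem hS, ae_restrict_of_ae (ae_expDom hsupp)] with u h1 h2
      exact ⟨h1, h2⟩
    · intro u hu v hv h1 h2
      refine hm u hu v hv ((hlt u).1 ?_) ((hle v).1 ?_)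
      · by_contra! h
        exact absurd h1 (not_lt.2 (ENNReal.ofReal_le_ofReal h))
      · exact (ENNReal.ofReal_le_ofReal_iff (hC0 v)).1 h2
  have hRfin := hch (Set.Ioi θ₀) (phi ν H) measurableSet_Ioi
    (measurable_phi ν H hH.measurable) heR (by
      intro u hu v hv h1 h2
      refine phi_anti hν hv.2 hu.2 ?_ H hH
      by_contra! h
      exact absurd h1 (not_lt.2 (conv_three hgc (le_of_lt hu.1) h.le hθ h2)))
  have hLfin := hch (Set.Iic θ₀) (phi ν K) measurableSet_Iic
    (measurable_phi ν K hK.measurable) heL (by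
      intro u hu v hv h1 h2
      refine phi_mono hν hu.2 hv.2 ?_ K hK
      by_contra! h
      exact absurd h1 (not_lt.2 (conv_three hgc h.le hu.1 h2 hθ)))
  rw [hsplit _ _ (measurable_phi ν H hH.measurable),
    hsplitC _ _ (measurable_phi ν H hH.measurable)] at hRfin
  rw [hsplit _ _ (measurable_phi ν K hK.measurable),
    hsplitC _ _ (measurable_phi ν K hK.measurable)] at hLfin
  calc _ = _ := by rw [mul_add, mul_add, add_add_add_comm]
    _ ≤ _ := add_le_add hRfin hLfin
    _ = _ := by rw [mul_add]

/-- If `f : [0,1] → [0,∞)` is concave, then `p ↦ (T_n f)(p)` is concave on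
`(0,1)` for every `n`. -/
theorem T_preserves_concavity (ν μ : Measure ℝ) [SigmaFinite ν]
    [IsProbabilityMeasure μ] (θ₀ : ℝ) (Y : ℕ → ℝ → ℝ)
    (hsupp : msupport μ ⊆ interior (expDom ν))
    (h0 : 0 < μ (Set.Ioi θ₀)) (h1 : μ (Set.Ioi θ₀) < 1)
    (hint : ∀ (n : ℕ) (y : ℝ),
      Integrable (fun u => (1 + |u|) * Real.exp (u * y - (n : ℝ) * cgf ν u)) μ)
    (hY : ∀ (n : ℕ), ∀ p ∈ Set.Ioo (0 : ℝ) 1, q ν μ θ₀ n (Y n p) = p)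
    (f : ℝ → ℝ) (hf : ConcaveOn ℝ (Set.Icc 0 1) f)
    (hf0 : ∀ x ∈ Set.Icc (0 : ℝ) 1, 0 ≤ f x)
    (n : ℕ) :
    ConcaveOn ℝ (Set.Ioo 0 1) (T ν μ θ₀ Y n f) := by
  by_cases hν : ν = 0
  · subst hν
    have : T 0 μ θ₀ Y n f = fun _ => (0 : ℝ) := by
      funext p; simp [T]
    rw [this]
    exact concaveOn_const 0 (convex_Ioo 0 1)
  have hR : μ (Set.Ioi θ₀) ≠ 0 := h0.ne'
  have hL : μ (Set.Iic θ₀) ≠ 0 := by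
    intro h
    have := prob_compl_eq_zero_iff (μ := μ) (s := Set.Ioi θ₀) measurableSet_Ioi
    rw [Set.compl_Ioi] at this
    exact h1.ne (this.1 h)
  have hGp := fun n y => setInt_pos hint n y _ hR
  have hLp := fun n y => setInt_pos hint n y _ hL
  have hZs := Z_split hint θ₀
  have hZp : ∀ n y, 0 < Z ν μ n y := fun n y => by
    rw [hZs]; exact add_pos (hGp n y) (hLp n y)
  have hqmem : ∀ n y, q ν μ θ₀ n y ∈ Set.Ioo (0 : ℝ) 1 := by
    intro n y
    rw [q_eq]
    refine ⟨div_pos (hGp n y) (hZp n y), ?_⟩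
    rw [div_lt_one (hZp n y), hZs]
    linarith [hLp n y]
  have hqm := q_mono hint θ₀ hR hL
  choose! s hs using exists_supergrad f hf
  set F1 : ℝ → ℝ := fun x => f x + s x * (1 - x) with hF1
  set F2 : ℝ → ℝ := fun x => f x + s x * (0 - x) with hF2
  have hF1p : ∀ x ∈ Set.Ioo (0 : ℝ) 1, 0 ≤ F1 x := fun x hx =>
    (hf0 1 (by simp)).trans (hs x hx 1 (by simp))
  have hF2p : ∀ x ∈ Set.Ioo (0 : ℝ) 1, 0 ≤ F2 x := fun x hx =>
    (hf0 0 (by simp)).trans (hs x hx 0 (by simp))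
  have hFle : ∀ x ∈ Set.Ioo (0 : ℝ) 1, ∀ p ∈ Set.Ioo (0 : ℝ) 1,
      f p ≤ p * F1 x + (1 - p) * F2 x := by
    intro x hx p hp
    have := hs x hx p ⟨hp.1.le, hp.2.le⟩
    simp only [hF1, hF2]
    linarith
  have hFeq : ∀ p, f p = p * F1 p + (1 - p) * F2 p := by
    intro p
    simp only [hF1, hF2]
    ring
  have hsanti : ∀ x ∈ Set.Ioo (0 : ℝ) 1, ∀ z ∈ Set.Ioo (0 : ℝ) 1, x ≤ z →
      F1 z ≤ F1 x ∧ F2 x ≤ F2 z := by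
    intro x hx z hz hxz
    rcases hxz.eq_or_lt with rfl | hxz
    · exact ⟨le_rfl, le_rfl⟩
    have e1 := hs x hx z ⟨hz.1.le, hz.2.le⟩
    have e2 := hs z hz x ⟨hx.1.le, hx.2.le⟩
    have hss : s z ≤ s x := by
      by_contra! h
      nlinarith
    simp only [hF1, hF2]
    constructor
    · nlinarith [mul_le_mul_of_nonneg_right hss (sub_nonneg.2 hz.2.le)]
    · nlinarith [mul_le_mul_of_nonneg_right hss hx.1.le]
  have hanti : ∀ y, Antitone fun x => F1 (q ν μ θ₀ (n + 1) (y + x)) := fun y x z hxz =>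
    (hsanti _ (hqmem _ _) _ (hqmem _ _) (hqm _ (by linarith))).1
  have hmono : ∀ y, Monotone fun x => F2 (q ν μ θ₀ (n + 1) (y + x)) := fun y x z hxz =>
    (hsanti _ (hqmem _ _) _ (hqmem _ _) (hqm _ (by linarith))).2
  have hqmeas : ∀ y, Measurable fun x => q ν μ θ₀ (n + 1) (y + x) := fun y =>
    Monotone.measurable fun x z hxz => hqm _ (by linarith)
  -- the lower Lebesgue integral version
  set TL : ℝ → ENNReal := fun y => ∫⁻ x, ENNReal.ofReal (f (q ν μ θ₀ (n + 1) (y + x)) *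
      (Z ν μ (n + 1) (y + x) / Z ν μ n y)) ∂ν with hTL
  have hfnn : ∀ y, 0 ≤ f (q ν μ θ₀ (n + 1) y) := fun y =>
    hf0 _ ⟨(hqmem _ _).1.le, (hqmem _ _).2.le⟩
  have hZm : ∀ y, Measurable fun x => Z ν μ (n + 1) (y + x) := by
    intro y
    have hw : Measurable (fun p : ℝ × ℝ => wt ν (n + 1) p.1 p.2) := measurable_wt ν (n + 1)
    refine StronglyMeasurable.measurable ?_
    refine StronglyMeasurable.integral_prod_right (f := fun x u : ℝ => wt ν (n + 1) (y + x) u) ?_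
    refine Measurable.stronglyMeasurable ?_
    exact hw.comp ((measurable_const.add measurable_fst).prodMk measurable_snd)
  have hTeq : ∀ p, T ν μ θ₀ Y n f p = (TL (Y n p)).toReal := by
    intro p
    unfold T
    rw [integral_eq_lintegral_of_nonneg_ae]
    · refine Filter.Eventually.of_forall fun x => ?_
      exact mul_nonneg (hfnn _) (div_pos (hZp _ _) (hZp _ _)).le
    · refine Measurable.aestronglyMeasurable ?_
      refine Measurable.mul ?_ ((hZm _).div_const _)
      simp_rw [hFeq (q ν μ θ₀ (n + 1) _)]
      exact ((hqmeas _).mul (hanti _).measurable).add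
        ((measurable_const.sub (hqmeas _)).mul (hmono _).measurable)
  have hTLle : ∀ (y : ℝ) (h k : ℝ → ℝ), (∀ x, f (q ν μ θ₀ (n + 1) (y + x)) ≤
      q ν μ θ₀ (n + 1) (y + x) * h x + (1 - q ν μ θ₀ (n + 1) (y + x)) * k x) →
      TL y ≤ ∫⁻ x, ENNReal.ofReal ((q ν μ θ₀ (n + 1) (y + x) * h x +
        (1 - q ν μ θ₀ (n + 1) (y + x)) * k x) * (Z ν μ (n + 1) (y + x) / Z ν μ n y)) ∂ν := by
    intro y h k hh
    refine lintegral_mono fun x => ENNReal.ofReal_le_ofReal ?_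
    exact mul_le_mul_of_nonneg_right (hh x) (div_pos (hZp _ _) (hZp _ _)).le
  have hTLfin : ∀ y, TL y ≠ ⊤ := by
    intro y
    have hhalf : (1 / 2 : ℝ) ∈ Set.Ioo (0 : ℝ) 1 := by constructor <;> norm_num
    have hbd := hTLle y (fun _ => F1 (1 / 2)) (fun _ => F2 (1 / 2))
      (fun x => hFle _ hhalf _ (hqmem _ _))
    rw [TL_calc hint θ₀ hR hL n y _ _ measurable_const measurable_const
      (fun _ => hF1p _ hhalf) (fun _ => hF2p _ hhalf)] at hbd
    refine ne_top_of_le_ne_top ?_ hbd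
    have hconst : ∀ (S : Set ℝ) (M : ℝ), ∫⁻ u in S, phi ν (fun _ => ENNReal.ofReal M) u
            * ENNReal.ofReal (wt ν n y u) ∂μ ≠ ⊤ := by
      intro S M
      have hw : Measurable (fun u => ENNReal.ofReal (wt ν n y u)) :=
        ((measurable_wt ν n).comp (measurable_const.prodMk measurable_id)).ennreal_ofReal
      have : ∫⁻ u in S, phi ν (fun _ => ENNReal.ofReal M) u
            * ENNReal.ofReal (wt ν n y u) ∂μ
          = ∫⁻ u in S, ENNReal.ofReal M * ENNReal.ofReal (wt ν n y u) ∂μ := by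
        refine lintegral_congr_ae ?_
        filter_upwards [ae_restrict_of_ae (ae_expDom hsupp)] with u hu
        unfold phi
        rw [lintegral_const_mul _ (by fun_prop), lint_p hν hu, mul_one]
      rw [this, lintegral_const_mul _ hw,
        ← ofReal_integral_eq_lintegral_ofReal (wt_integrable hint n y).integrableOn
          (Filter.Eventually.of_forall fun u => (Real.exp_pos _).le)]
      exact ENNReal.mul_ne_top ENNReal.ofReal_ne_top ENNReal.ofReal_ne_top
    exact ENNReal.mul_ne_top ENNReal.ofReal_ne_top
      (ENNReal.add_ne_top.2 ⟨hconst _ _, hconst _ _⟩)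
  refine ⟨convex_Ioo 0 1, ?_⟩
  intro p₁ hp₁ p₂ hp₂ a b ha hb hab
  have hp₀ : a • p₁ + b • p₂ ∈ Set.Ioo (0 : ℝ) 1 := convex_Ioo 0 1 hp₁ hp₂ ha hb hab
  have E₁ := hY n p₁ hp₁
  have E₂ := hY n p₂ hp₂
  have E₀ := hY n _ hp₀
  rw [hTeq, hTeq, hTeq]
  generalize Y n (a • p₁ + b • p₂) = y₀ at *
  generalize Y n p₁ = y₁ at *
  generalize Y n p₂ = y₂ at *
  simp only [smul_eq_mul] at *
  have hkey : ENNReal.ofReal a * TL y₁ + ENNReal.ofReal b * TL y₂ ≤ TL y₀ := by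
    have hh0 : ∀ x, 0 ≤ F1 (q ν μ θ₀ (n + 1) (y₀ + x)) := fun x => hF1p _ (hqmem _ _)
    have hk0 : ∀ x, 0 ≤ F2 (q ν μ θ₀ (n + 1) (y₀ + x)) := fun x => hF2p _ (hqmem _ _)
    have hcalc := fun y => TL_calc hint θ₀ hR hL n y _ _ (hanti y₀).measurable
      (hmono y₀).measurable hh0 hk0
    have b₁ := hTLle y₁ _ _ (fun x => hFle _ (hqmem (n + 1) (y₀ + x)) _ (hqmem (n + 1) (y₁ + x)))
    have b₂ := hTLle y₂ _ _ (fun x => hFle _ (hqmem (n + 1) (y₀ + x)) _ (hqmem (n + 1) (y₂ + x)))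
    have b₀ : TL y₀ = _ := (lintegral_congr fun x => by
      rw [hFeq (q ν μ θ₀ (n + 1) (y₀ + x))]).trans (hcalc y₀)
    rw [hcalc] at b₁ b₂
    rw [b₀]
    refine (add_le_add (mul_le_mul_right b₁ _) (mul_le_mul_right b₂ _)).trans ?_
    rw [← mul_assoc, ← mul_assoc, ← ENNReal.ofReal_mul ha, ← ENNReal.ofReal_mul hb]
    have hZ1 := hZp n y₁
    have hZ2 := hZp n y₂
    have hZ0 := hZp n y₀
    have hq1 : ∀ y, (∫ u in Set.Ioi θ₀, wt ν n y u ∂μ) = q ν μ θ₀ n y * Z ν μ n y := fun y => by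
      rw [q_eq, div_mul_cancel₀ _ (hZp n y).ne']
    have hq2 : ∀ y, (∫ u in Set.Iic θ₀, wt ν n y u ∂μ) = (1 - q ν μ θ₀ n y) * Z ν μ n y :=
      fun y => by
        rw [sub_mul, ← hq1, one_mul, hZs]; ring
    refine weighted hν hsupp hint θ₀ hR hL n y₀ y₁ y₂ _ _ _ (by positivity) (by positivity)
      (by positivity) ?_ ?_ _ _ ?_ ?_
    · rw [hq1, hq1, hq1, E₀, E₁, E₂]
      field_simp
    · rw [hq2, hq2, hq2, E₀, E₁, E₂]
      field_simp
      linear_combination hab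
    · exact fun x z hxz => ENNReal.ofReal_le_ofReal (hanti y₀ hxz)
    · exact fun x z hxz => ENNReal.ofReal_le_ofReal (hmono y₀ hxz)
  have := ENNReal.toReal_mono (hTLfin y₀) hkey
  rw [ENNReal.toReal_add (ENNReal.mul_ne_top ENNReal.ofReal_ne_top (hTLfin _))
    (ENNReal.mul_ne_top ENNReal.ofReal_ne_top (hTLfin _)), ENNReal.toReal_mul,
    ENNReal.toReal_mul, ENNReal.toReal_ofReal ha, ENNReal.toReal_ofReal hb] at this
  exact this
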